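/- arXiv:1810.06939 — 2 statements merged into one kernel-verified Lean document; each statement's English description precedes it below -/
import Mathlib

section
/- Let X be a compact metric space and let E_N : M₁(X) → (−∞,+∞] be a sequence of functions on the space M₁(X) of Borel probability measures on X. Define the Legendre–Fenchel transforms E_N^*(u) := sup_{μ∈M₁(X)} (∫_X u dμ − E_N(μ)) for u ∈ C(X). Assume that for every u ∈ C(X) the limit f(u) := lim_{N→∞} E_N^*(u) exists in ℝ, and that f is Gateaux differentiable on C(X). Then E_N Γ-converges, on M₁(X) equipped with the weak topology, to E := f*, where f*(μ) := sup_{u∈C(X)} (∫_X u dμ − f(u)). -/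
open MeasureTheory Filter Topology
open scoped ENNReal NNReal

section aux
variable {X : Type*} [MetricSpace X] [CompactSpace X] [MeasurableSpace X] [BorelSpace X]

/-- pairing -/
noncomputable def gcPair (u : C(X, ℝ)) (μ : ProbabilityMeasure X) : ℝ :=
  ∫ x, u x ∂(μ : Measure X)

lemma gcPair_int (u : C(X, ℝ)) (μ : ProbabilityMeasure X) :
    Integrable (fun x => u x) (μ : Measure X) :=
  (BoundedContinuousFunction.mkOfCompact u).integrable (μ : Measure X)

lemma gcPair_add (u v : C(X, ℝ)) (μ : ProbabilityMeasure X) :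
    gcPair (u + v) μ = gcPair u μ + gcPair v μ := by
  simpa [gcPair] using integral_add (gcPair_int u μ) (gcPair_int v μ)

lemma gcPair_smul (t : ℝ) (v : C(X, ℝ)) (μ : ProbabilityMeasure X) :
    gcPair (t • v) μ = t * gcPair v μ := by
  simpa [gcPair] using integral_const_mul t (fun x => v x) (μ := (μ : Measure X))

lemma gcPair_sub (u v : C(X, ℝ)) (μ : ProbabilityMeasure X) :
    gcPair (u - v) μ = gcPair u μ - gcPair v μ := by
  simpa [gcPair] using integral_sub (gcPair_int u μ) (gcPair_int v μ)

lemma gcPair_abs (u : C(X, ℝ)) (μ : ProbabilityMeasure X) : |gcPair u μ| ≤ ‖u‖ := by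
  have := norm_integral_le_of_norm_le_const (μ := (μ : Measure X)) (f := fun x => u x) (C := ‖u‖)
    (Eventually.of_forall fun x => u.norm_coe_le_norm x)
  simpa [gcPair] using this

lemma gcPair_sum {ι : Type*} (s : Finset ι) (t : ι → ℝ) (v : ι → C(X, ℝ))
    (μ : ProbabilityMeasure X) :
    gcPair (∑ i ∈ s, t i • v i) μ = ∑ i ∈ s, t i * gcPair (v i) μ := by
  classical
  induction s using Finset.induction_on with
  | empty => simp [gcPair]
  | insert a s ha ih => rw [Finset.sum_insert ha, Finset.sum_insert ha, gcPair_add, gcPair_smul, ih]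

variable {E : ℕ → ProbabilityMeasure X → EReal} {f : C(X, ℝ) → ℝ}

lemma gc_upper (hlim : ∀ u : C(X, ℝ),
      Tendsto (fun N => ⨆ μ : ProbabilityMeasure X, ((gcPair u μ : ℝ) : EReal) - E N μ)
        atTop (𝓝 ((f u : ℝ) : EReal))) (v : C(X, ℝ)) {η : ℝ} (hη : 0 < η) :
    ∀ᶠ N in atTop, ∀ μ, E N μ ≠ ⊥ ∧ ∀ e : ℝ, E N μ = e → gcPair v μ - e < f v + η := by
  have h : ((f v : ℝ) : EReal) < ((f v + η : ℝ) : EReal) := by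
    exact_mod_cast (by linarith : f v < f v + η)
  filter_upwards [(hlim v).eventually_lt_const h] with N hN μ
  have h1 := (le_iSup (fun μ => ((gcPair v μ : ℝ) : EReal) - E N μ) μ).trans_lt hN
  refine ⟨fun hb => ?_, fun e he => ?_⟩
  · simp [hb] at h1
  · simp only [he] at h1
    exact_mod_cast h1

lemma gc_near (hlim : ∀ u : C(X, ℝ),
      Tendsto (fun N => ⨆ μ : ProbabilityMeasure X, ((gcPair u μ : ℝ) : EReal) - E N μ)
        atTop (𝓝 ((f u : ℝ) : EReal))) (u : C(X, ℝ)) {η : ℝ} (hη : 0 < η) :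
    ∀ᶠ N in atTop, ∃ μ, ∃ e : ℝ, E N μ = e ∧ f u - η < gcPair u μ - e := by
  have h : ((f u - η : ℝ) : EReal) < ((f u : ℝ) : EReal) := by
    exact_mod_cast (by linarith : f u - η < f u)
  filter_upwards [(hlim u).eventually_const_lt h, gc_upper hlim u hη] with N hN hN2
  obtain ⟨μ, hμ⟩ := lt_iSup_iff.1 hN
  refine ⟨μ, ?_⟩
  have hb := (hN2 μ).1
  have ht : E N μ ≠ ⊤ := by
    intro ht
    simp [ht] at hμ
  refine ⟨(E N μ).toReal, (EReal.coe_toReal ht hb).symm, ?_⟩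
  rw [← EReal.coe_toReal ht hb] at hμ
  exact_mod_cast hμ

lemma gc_lip (hlim : ∀ u : C(X, ℝ),
      Tendsto (fun N => ⨆ μ : ProbabilityMeasure X, ((gcPair u μ : ℝ) : EReal) - E N μ)
        atTop (𝓝 ((f u : ℝ) : EReal))) : Continuous f := by
  have key : ∀ u v, f u ≤ f v + ‖u - v‖ := by
    intro u v
    refine le_of_forall_pos_le_add fun η hη => ?_
    obtain ⟨N, ⟨μ, e, he, h1⟩, h2⟩ :=
      ((gc_near hlim u (half_pos hη)).and (gc_upper hlim v (half_pos hη))).exists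
    have h3 := (h2 μ).2 e he
    have h4 := (le_abs_self _).trans (gcPair_abs (u - v) μ)
    rw [gcPair_sub] at h4
    linarith
  refine (LipschitzWith.of_le_add_mul 1 fun u v => ?_).continuous
  simpa [dist_eq_norm] using key u v

lemma gc_grad (hlim : ∀ u : C(X, ℝ),
      Tendsto (fun N => ⨆ μ : ProbabilityMeasure X, ((gcPair u μ : ℝ) : EReal) - E N μ)
        atTop (𝓝 ((f u : ℝ) : EReal))) (u v : C(X, ℝ)) (l : ℝ)
    (hl : Tendsto (fun t : ℝ => (f (u + t • v) - f u) / t) (𝓝[≠] 0) (𝓝 l))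
    {ε : ℝ} (hε : 0 < ε) :
    ∀ᶠ η in 𝓝[>] (0:ℝ), ∀ᶠ N in atTop, ∀ μ, ∀ e : ℝ, E N μ = e → f u - η < gcPair u μ - e →
      |gcPair v μ - l| < ε := by
  have h1 : ∀ᶠ t in 𝓝[≠] (0:ℝ), |(f (u + t • v) - f u) / t - l| < ε / 2 := by
    have := (Metric.tendsto_nhds.1 hl) (ε / 2) (half_pos hε)
    simpa [Real.dist_eq] using this
  have hp : ∀ᶠ t in 𝓝[>] (0:ℝ), |(f (u + t • v) - f u) / t - l| < ε / 2 :=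
    h1.filter_mono (nhdsWithin_mono _ fun x hx => ne_of_gt hx)
  have hn : ∀ᶠ t in 𝓝[<] (0:ℝ), |(f (u + t • v) - f u) / t - l| < ε / 2 :=
    h1.filter_mono (nhdsWithin_mono _ fun x hx => ne_of_lt hx)
  obtain ⟨s, hs, hs0⟩ := (hp.and self_mem_nhdsWithin).exists
  obtain ⟨r, hr, hr0⟩ := (hn.and self_mem_nhdsWithin).exists
  replace hs0 : 0 < s := hs0
  replace hr0 : r < 0 := hr0
  have hsm : ∀ᶠ η in 𝓝[>] (0:ℝ), η < s * ε / 4 ∧ η < -r * ε / 4 := by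
    refine Eventually.filter_mono nhdsWithin_le_nhds ?_
    have a : 0 < s * ε / 4 := by positivity
    have b : 0 < -r * ε / 4 := by
      have : 0 < -r := by linarith
      positivity
    exact (eventually_lt_nhds a).and (eventually_lt_nhds b)
  filter_upwards [hsm, self_mem_nhdsWithin] with η ⟨hη1, hη2⟩ hη0
  filter_upwards [gc_upper hlim (u + s • v) hη0, gc_upper hlim (u + r • v) hη0]
    with N hN1 hN2 μ e he hμ
  have k1 := (hN1 μ).2 e he
  have k2 := (hN2 μ).2 e he
  rw [gcPair_add, gcPair_smul] at k1 k2
  rw [abs_lt] at hs hr ⊢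
  have m1 : f (u + s • v) - f u < (l + ε / 2) * s := by
    rw [← div_lt_iff₀ hs0]; linarith [hs.2]
  have m2 : f (u + r • v) - f u < (l - ε / 2) * r := by
    rw [← lt_div_iff_of_neg hr0]; linarith [hr.1]
  constructor
  · by_contra! hc
    nlinarith
  · by_contra! hc
    nlinarith

lemma gc_key (hlim : ∀ u : C(X, ℝ),
      Tendsto (fun N => ⨆ μ : ProbabilityMeasure X, ((gcPair u μ : ℝ) : EReal) - E N μ)
        atTop (𝓝 ((f u : ℝ) : EReal)))
    (hgateaux : ∀ u : C(X, ℝ), ∃ L : C(X, ℝ) →L[ℝ] ℝ, ∀ v : C(X, ℝ),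
      Tendsto (fun t : ℝ => (f (u + t • v) - f u) / t) (𝓝[≠] 0) (𝓝 (L v)))
    (μ₀ : ProbabilityMeasure X) (F : ℝ) (hF : ∀ u, gcPair u μ₀ - f u ≤ F)
    (k : ℕ) (v : Fin k → C(X, ℝ)) {ε : ℝ} (hε : 0 < ε) :
    ∀ᶠ N in atTop, ∃ μ, (∀ i, |gcPair (v i) μ - gcPair (v i) μ₀| < ε) ∧
      E N μ ≤ ((F + ε : ℝ) : EReal) := by
  have hcont := gc_lip hlim
  set C : ℝ := f 0 + F with hC
  have hC0 : 0 ≤ C := by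
    have := hF 0
    have h0 : gcPair (0 : C(X, ℝ)) μ₀ = 0 := by simp [gcPair]
    linarith
  obtain ⟨δ, hδ, hδC⟩ : ∃ δ : ℝ, 0 < δ ∧ 2 * δ * C < (ε / 2) ^ 2 := by
    refine ⟨ε ^ 2 / (8 * (C + 1)), by positivity, ?_⟩
    rw [show 2 * (ε ^ 2 / (8 * (C + 1))) * C = (ε / 2) ^ 2 * (C / (C + 1)) by field_simp; norm_num]
    have : C / (C + 1) < 1 := by rw [div_lt_one (by linarith)]; linarith
    have h2 : 0 < (ε / 2) ^ 2 := by positivity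
    nlinarith
  let U : (Fin k → ℝ) → C(X, ℝ) := fun t => ∑ i, t i • v i
  let h : (Fin k → ℝ) → ℝ := fun t => f (U t) - gcPair (U t) μ₀ + δ / 2 * ∑ i, t i ^ 2
  have hU : ∀ t, gcPair (U t) μ₀ = ∑ i, t i * gcPair (v i) μ₀ := fun t => gcPair_sum _ _ _ _
  have hUc : Continuous U := by fun_prop
  have hhc : Continuous h := by
    simp only [h, hU]
    fun_prop
  have hlow : ∀ t, -F + δ / 2 * ∑ i, t i ^ 2 ≤ h t := by
    intro t
    have := hF (U t)
    simp only [h]; linarith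
  have hh0 : h 0 = f 0 := by simp [h, U, gcPair]
  obtain ⟨t, ht⟩ : ∃ t, ∀ s, h t ≤ h s := by
    refine hhc.exists_forall_le' 0 ?_
    have hev := (tendsto_norm_cocompact_atTop (E := Fin k → ℝ)).eventually_gt_atTop
      (Real.sqrt (2 * C / δ))
    filter_upwards [hev] with s hs
    by_contra! hc
    have h1 := hlow s
    rw [hh0] at hc
    have h2 : ∑ i, s i ^ 2 ≤ 2 * C / δ := by
      rw [le_div_iff₀ hδ]; linarith
    have h3 : ‖s‖ ≤ Real.sqrt (2 * C / δ) := by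
      rw [pi_norm_le_iff_of_nonneg (Real.sqrt_nonneg _)]
      intro i
      rw [Real.norm_eq_abs]
      apply Real.abs_le_sqrt
      exact (Finset.single_le_sum (f := fun i => s i ^ 2) (fun i _ => sq_nonneg _)
        (Finset.mem_univ i)).trans h2
    linarith
  obtain ⟨L, hL⟩ := hgateaux (U t)
  have hcrit : ∀ i, L (v i) - gcPair (v i) μ₀ + δ * t i = 0 := by
    intro i
    have hUe : ∀ s : ℝ, U (t + s • Pi.single i 1) = U t + s • v i := by
      intro s
      simp only [U, Pi.add_apply, Pi.smul_apply, add_smul, Finset.sum_add_distrib]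
      congr 1
      rw [Finset.sum_eq_single i]
      · simp
      · intro j _ hj; simp [hj]
      · simp
    have d1 : HasDerivAt (fun s : ℝ => f (U t + s • v i)) (L (v i)) 0 := by
      rw [hasDerivAt_iff_tendsto_slope]
      refine (hL (v i)).congr fun s => ?_
      simp [slope_def_field]
    have hsq : ∀ s : ℝ, ∑ j, (t + s • (Pi.single i 1 : Fin k → ℝ)) j ^ 2
        = ∑ j, t j ^ 2 + (2 * t i * s + s ^ 2) := by
      intro s
      rw [← sub_eq_iff_eq_add', ← Finset.sum_sub_distrib, Finset.sum_eq_single i]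
      · simp; ring
      · intro j _ hj; simp [hj]
      · simp
    have hfun : (fun s : ℝ => h (t + s • Pi.single i 1)) = fun s : ℝ =>
        f (U t + s • v i) - (gcPair (U t) μ₀ + s * gcPair (v i) μ₀)
          + δ / 2 * (∑ j, t j ^ 2 + (2 * t i * s + s ^ 2)) := by
      funext s
      simp only [h, hUe, hsq, gcPair_add, gcPair_smul]
    have d2 : HasDerivAt (fun s : ℝ => h (t + s • Pi.single i 1))
        (L (v i) - gcPair (v i) μ₀ + δ * t i) 0 := by
      rw [hfun]
      have e1 : HasDerivAt (fun s : ℝ => gcPair (U t) μ₀ + s * gcPair (v i) μ₀)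
          (1 * gcPair (v i) μ₀) 0 := ((hasDerivAt_id (0:ℝ)).mul_const _).const_add _
      have e2 : HasDerivAt (fun s : ℝ => δ / 2 * (∑ j, t j ^ 2 + (2 * t i * s + s ^ 2)))
          (δ / 2 * (2 * t i * 1 + 2 * (0:ℝ) ^ 1 * 1)) 0 := by
        refine HasDerivAt.const_mul _ (HasDerivAt.const_add _ ?_)
        exact ((hasDerivAt_id (0:ℝ)).const_mul _).add (by simpa using hasDerivAt_pow 2 (0:ℝ))
      have e3 := (d1.sub e1).add e2
      rw [show L (v i) - gcPair (v i) μ₀ + δ * t i = L (v i) - 1 * gcPair (v i) μ₀ +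
        δ / 2 * (2 * t i * 1 + 2 * (0:ℝ) ^ 1 * 1) by ring]
      exact e3
    refine IsLocalMin.hasDerivAt_eq_zero (Eventually.of_forall fun s => ?_) d2
    simpa using ht (t + s • Pi.single i 1)
  have hsm : ∀ i, |δ * t i| < ε / 2 := by
    intro i
    apply abs_lt_of_sq_lt_sq _ (by positivity)
    have h1 := (hlow t).trans (ht 0)
    rw [hh0] at h1
    have h2 := Finset.single_le_sum (f := fun i => t i ^ 2) (fun i _ => sq_nonneg _)
        (Finset.mem_univ i)
    have h3 : δ * t i ^ 2 ≤ 2 * C := by nlinarith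
    nlinarith
  have hLU : L (U t) ≤ gcPair (U t) μ₀ := by
    rw [hU]
    simp only [U, map_sum, map_smul, smul_eq_mul]
    refine Finset.sum_le_sum fun i _ => ?_
    have : L (v i) = gcPair (v i) μ₀ - δ * t i := by linarith [hcrit i]
    rw [this]
    nlinarith [mul_nonneg hδ.le (sq_nonneg (t i))]
  have hA := (eventually_all.2 fun i => gc_grad hlim (U t) (v i) (L (v i)) (hL _) (half_pos hε))
  have hB := gc_grad hlim (U t) (U t) (L (U t)) (hL _) (half_pos hε)
  have hη : ∀ᶠ η in 𝓝[>] (0:ℝ), η < ε / 2 :=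
    (eventually_lt_nhds (half_pos hε)).filter_mono nhdsWithin_le_nhds
  obtain ⟨η, ⟨⟨hA, hB⟩, hη⟩, hη0⟩ := (((hA.and hB).and hη).and self_mem_nhdsWithin).exists
  filter_upwards [eventually_all.2 hA, hB, gc_near hlim (U t) hη0] with N h1 h2 ⟨μ, e, he, hμ⟩
  refine ⟨μ, fun i => ?_, ?_⟩
  · have a := h1 i μ e he hμ
    have b := hsm i
    rw [abs_lt] at a b ⊢
    have := hcrit i
    constructor <;> linarith
  · have a := (abs_lt.1 (h2 μ e he hμ)).2
    have b := hF (U t)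
    rw [he]
    exact_mod_cast (by linarith : e ≤ F + ε)

lemma gc_liminf (hlim : ∀ u : C(X, ℝ),
      Tendsto (fun N => ⨆ μ : ProbabilityMeasure X, ((gcPair u μ : ℝ) : EReal) - E N μ)
        atTop (𝓝 ((f u : ℝ) : EReal)))
    (μ : ProbabilityMeasure X) (μs : ℕ → ProbabilityMeasure X) (h : Tendsto μs atTop (𝓝 μ)) :
    (⨆ u : C(X, ℝ), ((gcPair u μ : ℝ) : EReal) - ((f u : ℝ) : EReal))
        ≤ liminf (fun N => E N (μs N)) atTop := by
  refine iSup_le fun u => ?_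
  have hu : Tendsto (fun N => gcPair u (μs N)) atTop (𝓝 (gcPair u μ)) :=
    (ProbabilityMeasure.tendsto_iff_forall_integral_tendsto.1 h)
      (BoundedContinuousFunction.mkOfCompact u)
  refine le_of_forall_lt fun c hc => ?_
  obtain ⟨r, hcr, hr⟩ := EReal.lt_iff_exists_real_btwn.1 hc
  have hr' : r < gcPair u μ - f u := by exact_mod_cast hr
  refine hcr.trans_le (le_liminf_of_le (by isBoundedDefault) ?_)
  set η := (gcPair u μ - f u - r) / 2 with hη
  have hη0 : 0 < η := by linarith
  filter_upwards [gc_upper hlim u hη0, hu.eventually_const_lt (by linarith :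
    gcPair u μ - η < gcPair u μ)] with N h1 h2
  by_cases ht : E N (μs N) = ⊤
  · simp [ht]
  have hb := (h1 (μs N)).1
  have h3 := (h1 (μs N)).2 _ (EReal.coe_toReal ht hb).symm
  rw [← EReal.coe_toReal ht hb]
  exact_mod_cast (by linarith : r ≤ (E N (μs N)).toReal)

lemma gc_dense (μ : ProbabilityMeasure X) (μs : ℕ → ProbabilityMeasure X) (v : ℕ → C(X, ℝ))
    (hv : DenseRange v)
    (h : ∀ i, Tendsto (fun N => gcPair (v i) (μs N)) atTop (𝓝 (gcPair (v i) μ))) :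
    Tendsto μs atTop (𝓝 μ) := by
  rw [ProbabilityMeasure.tendsto_iff_forall_integral_tendsto]
  intro g
  let u : C(X, ℝ) := g.toContinuousMap
  change Tendsto (fun N => gcPair u (μs N)) atTop (𝓝 (gcPair u μ))
  rw [Metric.tendsto_nhds]
  intro ε hε
  obtain ⟨i, hi⟩ := hv.exists_dist_lt u (by positivity : 0 < ε / 3)
  rw [dist_eq_norm] at hi
  filter_upwards [Metric.tendsto_nhds.1 (h i) (ε / 3) (by positivity)] with N hN
  rw [Real.dist_eq] at hN ⊢
  have a := abs_le.1 (gcPair_abs (u - v i) (μs N))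
  have b := abs_le.1 (gcPair_abs (u - v i) μ)
  rw [gcPair_sub] at a b
  rw [abs_lt] at hN ⊢
  constructor <;> linarith [a.1, a.2, b.1, b.2, hN.1, hN.2]

lemma gc_recovery (hlim : ∀ u : C(X, ℝ),
      Tendsto (fun N => ⨆ μ : ProbabilityMeasure X, ((gcPair u μ : ℝ) : EReal) - E N μ)
        atTop (𝓝 ((f u : ℝ) : EReal)))
    (hgateaux : ∀ u : C(X, ℝ), ∃ L : C(X, ℝ) →L[ℝ] ℝ, ∀ v : C(X, ℝ),
      Tendsto (fun t : ℝ => (f (u + t • v) - f u) / t) (𝓝[≠] 0) (𝓝 (L v)))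
    (μ : ProbabilityMeasure X) : ∃ μs : ℕ → ProbabilityMeasure X,
      Tendsto μs atTop (𝓝 μ) ∧
      Tendsto (fun N => E N (μs N)) atTop
        (𝓝 (⨆ u : C(X, ℝ), ((gcPair u μ : ℝ) : EReal) - ((f u : ℝ) : EReal))) := by
  classical
  set S : EReal := ⨆ u : C(X, ℝ), ((gcPair u μ : ℝ) : EReal) - ((f u : ℝ) : EReal) with hS
  by_cases hT : S = ⊤
  · refine ⟨fun _ => μ, tendsto_const_nhds, ?_⟩
    refine tendsto_of_le_liminf_of_limsup_le
      (gc_liminf hlim μ (fun _ => μ) tendsto_const_nhds) ?_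
    rw [hT]; exact le_top
  have hle : ∀ u, ((gcPair u μ - f u : ℝ) : EReal) ≤ S := fun u => by
    rw [EReal.coe_sub]
    exact le_iSup (fun u : C(X, ℝ) => ((gcPair u μ : ℝ) : EReal) - ((f u : ℝ) : EReal)) u
  have hB : S ≠ ⊥ := fun hB => by
    have := hle 0
    rw [hB] at this
    exact EReal.coe_ne_bot _ (le_bot_iff.1 this)
  obtain ⟨F, hF⟩ : ∃ F : ℝ, S = F := ⟨S.toReal, (EReal.coe_toReal hT hB).symm⟩
  have hFle : ∀ u, gcPair u μ - f u ≤ F := fun u => by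
    have := hle u
    rw [hF] at this
    exact_mod_cast this
  obtain ⟨v, hv⟩ := TopologicalSpace.exists_dense_seq C(X, ℝ)
  let Q : ℕ → ℕ → ProbabilityMeasure X → Prop := fun k N ν =>
    (∀ i < k, |gcPair (v i) ν - gcPair (v i) μ| < 1 / ((k : ℝ) + 1)) ∧
      E N ν ≤ ((F + 1 / ((k : ℝ) + 1) : ℝ) : EReal)
  have hP : ∀ k, ∀ᶠ N in atTop, ∃ ν, Q k N ν := by
    intro k
    filter_upwards [gc_key hlim hgateaux μ F hFle k (fun i => v i)
      (by positivity : 0 < 1 / ((k : ℝ) + 1))] with N ⟨ν, h1, h2⟩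
    exact ⟨ν, fun i hi => h1 ⟨i, hi⟩, h2⟩
  let κ : ℕ → ℕ := fun N => Nat.findGreatest (fun k => ∃ ν, Q k N ν) N
  have hκ : Tendsto κ atTop atTop := by
    rw [tendsto_atTop]
    intro k
    filter_upwards [hP k, eventually_ge_atTop k] with N h1 h2
    exact Nat.le_findGreatest h2 h1
  have hκP : ∀ᶠ N in atTop, ∃ ν, Q (κ N) N ν := by
    filter_upwards [hP 0] with N h1
    exact Nat.findGreatest_spec (P := fun k => ∃ ν, Q k N ν) (Nat.zero_le N) h1
  let μs : ℕ → ProbabilityMeasure X := fun N => if h : ∃ ν, Q (κ N) N ν then h.choose else μ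
  have hμs : ∀ᶠ N in atTop, Q (κ N) N (μs N) := by
    filter_upwards [hκP] with N h
    simp only [μs, dif_pos h]
    exact h.choose_spec
  have hsmall : ∀ ε : ℝ, 0 < ε → ∀ᶠ N in atTop, 1 / ((κ N : ℝ) + 1) < ε := fun ε hε =>
    (tendsto_one_div_add_atTop_nhds_zero_nat.comp hκ).eventually_lt_const hε
  have hconv : Tendsto μs atTop (𝓝 μ) := by
    refine gc_dense μ μs v hv fun i => ?_
    rw [Metric.tendsto_nhds]
    intro ε hε
    filter_upwards [hμs, hsmall ε hε, hκ.eventually_gt_atTop i] with N h1 h2 h3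
    rw [Real.dist_eq]
    exact (h1.1 i h3).trans h2
  refine ⟨μs, hconv, tendsto_of_le_liminf_of_limsup_le (gc_liminf hlim μ μs hconv) ?_⟩
  rw [hF]
  refine le_of_forall_gt fun c hc => ?_
  obtain ⟨r, hr, hrc⟩ := EReal.lt_iff_exists_real_btwn.1 hc
  have hr' : F < r := by exact_mod_cast hr
  refine lt_of_le_of_lt (limsup_le_of_le (by isBoundedDefault) ?_) hrc
  filter_upwards [hμs, hsmall (r - F) (by linarith)] with N h1 h2
  refine h1.2.trans ?_
  exact_mod_cast (by linarith : F + 1 / ((κ N : ℝ) + 1) ≤ r)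

end aux

/-- Let `X` be a compact metric space and `E_N : M₁(X) → (-∞,+∞]`. If the
Legendre–Fenchel transforms `E_N^*(u) = sup_μ (∫ u dμ - E_N(μ))` converge pointwise on
`C(X)` to a Gateaux differentiable function `f : C(X) → ℝ`, then `E_N` Γ-converges, on
`M₁(X)` with the weak topology, to `f*`. -/
theorem gamma_convergence_from_legendre_transforms
    {X : Type*} [MetricSpace X] [CompactSpace X] [MeasurableSpace X] [BorelSpace X]
    (E : ℕ → ProbabilityMeasure X → EReal) (f : C(X, ℝ) → ℝ)
    (hlim : ∀ u : C(X, ℝ),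
      Tendsto (fun N => ⨆ μ : ProbabilityMeasure X,
          (((∫ x, u x ∂(μ : Measure X)) : ℝ) : EReal) - E N μ)
        atTop (𝓝 ((f u : ℝ) : EReal)))
    (hgateaux : ∀ u : C(X, ℝ), ∃ L : C(X, ℝ) →L[ℝ] ℝ, ∀ v : C(X, ℝ),
      Tendsto (fun t : ℝ => (f (u + t • v) - f u) / t) (𝓝[≠] 0) (𝓝 (L v))) :
    (∀ (μ : ProbabilityMeasure X) (μs : ℕ → ProbabilityMeasure X),
      Tendsto μs atTop (𝓝 μ) →
      (⨆ u : C(X, ℝ), (((∫ x, u x ∂(μ : Measure X)) : ℝ) : EReal) - ((f u : ℝ) : EReal))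
        ≤ liminf (fun N => E N (μs N)) atTop) ∧
    (∀ μ : ProbabilityMeasure X, ∃ μs : ℕ → ProbabilityMeasure X,
      Tendsto μs atTop (𝓝 μ) ∧
      Tendsto (fun N => E N (μs N)) atTop
        (𝓝 (⨆ u : C(X, ℝ),
          (((∫ x, u x ∂(μ : Measure X)) : ℝ) : EReal) - ((f u : ℝ) : EReal)))) := by
  exact ⟨fun μ μs h => gc_liminf hlim μ μs h, fun μ => gc_recovery hlim hgateaux μ⟩
end

section
/- Let P ⊂ ℝⁿ be a convex body containing 0 in its interior, and for each k let p₁,…,p_{N_k} enumerate P ∩ (k⁻¹ℤ)ⁿ and E_trop^{(N_k)}(x₁,…,x_{N_k}) := (1/N_k)·max_{σ∈S_{N_k}} Σ_{i=1}^{N_k} ⟨x_i, p_{σ(i)}⟩. Let μ be a Borel probability measure on ℝⁿ with ∫‖x‖ dμ < ∞, and suppose x^{(k)} ∈ (ℝⁿ)^{N_k} are configurations whose empirical measures δ_{N_k}(x^{(k)}) converge weakly to μ and whose first moments converge, ∫‖x‖ dδ_{N_k}(x^{(k)}) → ∫‖x‖ dμ. Then −E_trop^{(N_k)}(x^{(k)})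 → C(μ, ν_P) as k → ∞, where ν_P is the uniform (normalized Lebesgue) probability measure on P. -/
open MeasureTheory Filter Topology
open scoped ENNReal NNReal RealInnerProductSpace BoundedContinuousFunction

noncomputable section

/-- The empirical measure `(1/N) ∑ δ_{x i}` of a configuration in `ℝⁿ`. -/
def empiricalE {n : ℕ} (N : ℕ) (x : Fin N → EuclideanSpace ℝ (Fin n)) :
    Measure (EuclideanSpace ℝ (Fin n)) :=
  (N : ℝ≥0∞)⁻¹ • ∑ i : Fin N, Measure.dirac (x i)

/-- The optimal transport cost between `μ₀` and `μ₁` for the cost `c(x,y) = -⟨x,y⟩`. -/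
def otCost {n : ℕ} (μ₀ μ₁ : Measure (EuclideanSpace ℝ (Fin n))) : ℝ :=
  sInf {c : ℝ | ∃ γ : Measure (EuclideanSpace ℝ (Fin n) × EuclideanSpace ℝ (Fin n)),
    IsProbabilityMeasure γ ∧ γ.map Prod.fst = μ₀ ∧ γ.map Prod.snd = μ₁ ∧
    c = ∫ q, -⟪q.1, q.2⟫ ∂γ}

/-- The lattice points `P ∩ (k⁻¹ℤ)ⁿ`. -/
def lattPts {n : ℕ} (P : Set (EuclideanSpace ℝ (Fin n))) (k : ℕ) :
    Set (EuclideanSpace ℝ (Fin n)) :=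
  {x | x ∈ P ∧ ∀ i : Fin n, ∃ m : ℤ, x i = (m : ℝ) / (k : ℝ)}

/-- The tropical energy `E_trop^{(N)}(x) = (1/N) max_σ ∑ ⟨x_i, p_{σ(i)}⟩`. -/
def tropEnergy {n N : ℕ} (p x : Fin N → EuclideanSpace ℝ (Fin n)) : ℝ :=
  (1 / (N : ℝ)) *
    (Finset.univ : Finset (Equiv.Perm (Fin N))).sup' Finset.univ_nonempty
      (fun σ => ∑ i, ⟪x i, p (σ i)⟫)

/-- The uniform (normalized Lebesgue) probability measure on `P`. -/
def unifOn {n : ℕ} (P : Set (EuclideanSpace ℝ (Fin n))) :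
    Measure (EuclideanSpace ℝ (Fin n)) :=
  (volume P)⁻¹ • volume.restrict P

end


namespace TropAux

/-- Closed-walk form of cyclical monotonicity. -/
def CM {E : Type*} [NormedAddCommGroup E] [InnerProductSpace ℝ E] (S : Set (E × E)) : Prop :=
  ∀ (m : ℕ) (q : ℕ → E × E), (∀ t, q t ∈ S) → q m = q 0 →
    ∑ t ∈ Finset.range m, ⟪(q (t + 1)).1 - (q t).1, (q t).2⟫ ≤ 0

/-- chains -/
inductive Ch {E : Type*} [NormedAddCommGroup E] [InnerProductSpace ℝ E] (S : Set (E × E))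
    (s : E × E) : E × E → ℝ → Prop
  | base : Ch S s s 0
  | step (q q' : E × E) (c : ℝ) : Ch S s q c → q' ∈ S →
      Ch S s q' (c + ⟪q'.1 - q.1, q.2⟫)

lemma Ch.exists_walk {E : Type*} [NormedAddCommGroup E] [InnerProductSpace ℝ E] {S : Set (E × E)}
    {s : E × E} (hs : s ∈ S) {q : E × E} {c : ℝ} (h : Ch S s q c) :
    ∃ (m : ℕ) (w : ℕ → E × E), (∀ t, w t ∈ S) ∧ w 0 = s ∧ w m = q ∧
      c = ∑ t ∈ Finset.range m, ⟪(w (t + 1)).1 - (w t).1, (w t).2⟫ := by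
  induction h with
  | base => exact ⟨0, fun _ => s, fun _ => hs, rfl, rfl, by simp⟩
  | step q q' c h hq' ih =>
    obtain ⟨m, w, hw, h0, hm, hc⟩ := ih
    refine ⟨m + 1, fun t => if t ≤ m then w t else q', ?_, by simp [h0], by simp, ?_⟩
    · intro t
      dsimp only
      split_ifs
      · exact hw t
      · exact hq'
    · rw [Finset.sum_range_succ]
      congr 1
      · rw [hc]
        refine Finset.sum_congr rfl fun t ht => ?_
        have := Finset.mem_range.1 ht
        simp [show t + 1 ≤ m by omega, show t ≤ m by omega]
      · simp [hm]

lemma Ch.le_zero {E : Type*} [NormedAddCommGroup E] [InnerProductSpace ℝ E] {S : Set (E × E)}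
    (hS : CM S)
    {s : E × E} (hs : s ∈ S) {q : E × E} {c : ℝ} (h : Ch S s q c) :
    c + ⟪s.1 - q.1, q.2⟫ ≤ 0 := by
  obtain ⟨m, w, hw, h0, hm, hc⟩ := (Ch.step q s c h hs).exists_walk hs
  rw [hc]
  exact hS m w hw (hm.trans h0.symm)

lemma Ch.norm_le {E : Type*} [NormedAddCommGroup E] [InnerProductSpace ℝ E] {S : Set (E × E)}
    {R : ℝ} (hR : ∀ q ∈ S, ‖q.2‖ ≤ R)
    {s : E × E} (hs : s ∈ S) {q : E × E} {c : ℝ} (h : Ch S s q c) : ‖q.2‖ ≤ R := by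
  cases h with
  | base => exact hR _ hs
  | step q q' c h hq => exact hR _ hq

/-- Rockafellar's theorem. -/
lemma rockafellar {E : Type*} [NormedAddCommGroup E] [InnerProductSpace ℝ E] {S : Set (E × E)}
    (hS : CM S) (hne : S.Nonempty) {R : ℝ} (hR : ∀ q ∈ S, ‖q.2‖ ≤ R) :
    ∃ φ : E → ℝ, (∀ x y, φ x ≤ φ y + R * ‖x - y‖) ∧
      ∀ q ∈ S, ∀ x, φ q.1 + ⟪x - q.1, q.2⟫ ≤ φ x := by
  obtain ⟨s, hs⟩ := hne
  let T := {p : (E × E) × ℝ // Ch S s p.1 p.2}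
  have : Nonempty T := ⟨⟨(s, 0), Ch.base⟩⟩
  let F : E → T → ℝ := fun x p => p.1.2 + ⟪x - p.1.1.1, p.1.1.2⟫
  have hlip : ∀ x y p, F x p ≤ F y p + R * ‖x - y‖ := by
    intro x y p
    have h1 : F x p = F y p + ⟪x - y, p.1.1.2⟫ := by
      simp only [F, inner_sub_left]; ring
    have h2 := real_inner_le_norm (x - y) p.1.1.2
    have h3 := Ch.norm_le hR hs p.2
    have := mul_le_mul_of_nonneg_left h3 (norm_nonneg (x - y))
    rw [h1]; nlinarith
  have hb : ∀ x, BddAbove (Set.range (F x)) := by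
    intro x
    refine ⟨0 + R * ‖x - s.1‖, ?_⟩
    rintro _ ⟨p, rfl⟩
    refine (hlip x s.1 p).trans ?_
    have : F s.1 p ≤ 0 := Ch.le_zero hS hs p.2
    linarith
  refine ⟨fun x => ⨆ p, F x p, ?_, ?_⟩
  · intro x y
    refine ciSup_le fun p => (hlip x y p).trans ?_
    have := le_ciSup (hb y) p
    linarith
  · intro q hq x
    rw [← le_sub_iff_add_le]
    refine ciSup_le fun p => ?_
    rw [le_sub_iff_add_le]
    exact le_ciSup (hb x) ⟨(q, _), Ch.step p.1.1 q p.1.2 p.2 hq⟩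

/-- Finite optimality implies cyclical monotonicity. -/
lemma finite_CM {E : Type*} [NormedAddCommGroup E] [InnerProductSpace ℝ E] {N : ℕ}
    (x p : Fin N → E)
    (hopt : ∀ τ : Equiv.Perm (Fin N), ∑ i, ⟪x i, p (τ i)⟫ ≤ ∑ i, ⟪x i, p i⟫) :
    CM (Set.range fun i => (x i, p i)) := by
  intro m q hq hm
  choose i hi using hq
  wlog him : i m = i 0 generalizing i
  · refine this (fun t => if t = m then i 0 else i t) (fun t => ?_) ?_
    · by_cases h : t = m
      · subst h; simp only [if_true]; rw [hm]; exact hi 0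
      · simp [h, ← hi]
    · by_cases h : (0:ℕ) = m
      · simp [h]
      · simp [h]
  rcases Nat.eq_zero_or_pos m with rfl | hmpos
  · simp
  have hm0 : (0:ℝ) < m := by exact_mod_cast hmpos
  let c : Fin N → Fin N → ℝ := fun a b => ∑ t ∈ Finset.range m,
    (if i (t+1) = a ∧ i t = b then (1:ℝ) else 0)
  let d : Fin N → ℝ := fun a => ∑ t ∈ Finset.range m, if i t = a then (1:ℝ) else 0
  have hd' : ∀ a, (∑ t ∈ Finset.range m, if i (t+1) = a then (1:ℝ) else 0) = d a := by
    intro a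
    have h1 := Finset.sum_range_succ (fun t => if i t = a then (1:ℝ) else 0) m
    have h2 := Finset.sum_range_succ' (fun t => if i t = a then (1:ℝ) else 0) m
    rw [h1, him] at h2
    simp only [d]; linarith
  have hrow : ∀ a, ∑ b, c a b = d a := by
    intro a
    rw [← hd', Finset.sum_comm]
    refine Finset.sum_congr rfl fun t _ => ?_
    by_cases h : i (t+1) = a <;> simp [h]
  have hcol : ∀ b, ∑ a, c a b = d b := by
    intro b
    rw [Finset.sum_comm]
    refine Finset.sum_congr rfl fun t _ => ?_
    by_cases h : i t = b <;> simp [h]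
  have hdm : ∀ a, d a ≤ m := by
    intro a
    calc d a ≤ ∑ t ∈ Finset.range m, (1:ℝ) := Finset.sum_le_sum fun t _ => by split_ifs <;> simp
      _ = m := by simp
  have hc0 : ∀ a b, 0 ≤ c a b := fun a b => Finset.sum_nonneg fun t _ => by split_ifs <;> simp
  let D : Matrix (Fin N) (Fin N) ℝ := Matrix.of fun a b =>
    (if a = b then 1 - d a / m else 0) + c a b / m
  have hD : D ∈ doublyStochastic ℝ (Fin N) := by
    rw [mem_doublyStochastic_iff_sum]
    refine ⟨fun a b => ?_, fun a => ?_, fun b => ?_⟩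
    · have h1 : d a / m ≤ 1 := (div_le_one hm0).2 (hdm a)
      have h2 := div_nonneg (hc0 a b) hm0.le
      simp only [D, Matrix.of_apply]
      split_ifs <;> linarith
    · simp [D, Finset.sum_add_distrib, ← Finset.sum_div, hrow]
    · simp [D, Finset.sum_add_distrib, ← Finset.sum_div, hcol]
  obtain ⟨w, hw0, hw1, hwD⟩ := exists_eq_sum_perm_of_mem_doublyStochastic hD
  have key : ∑ a, ∑ b, D a b * ⟪x a, p b⟫ ≤ ∑ a, ⟪x a, p a⟫ := by
    have e1 : ∑ a, ∑ b, D a b * ⟪x a, p b⟫ = ∑ σ, w σ * ∑ a, ⟪x a, p (σ a)⟫ := by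
      rw [← hwD]
      simp only [Matrix.sum_apply, Matrix.smul_apply, Finset.sum_mul, smul_eq_mul]
      simp_rw [Finset.sum_comm (s := Finset.univ) (t := (Finset.univ : Finset (Equiv.Perm (Fin N)))),
        Finset.mul_sum]
      refine Finset.sum_congr rfl fun σ _ => Finset.sum_congr rfl fun a _ => ?_
      simp [Equiv.Perm.permMatrix, PEquiv.toMatrix_apply, Equiv.toPEquiv_apply, ite_mul, mul_ite]
    rw [e1]
    calc _ ≤ ∑ σ, w σ * ∑ a, ⟪x a, p a⟫ :=
          Finset.sum_le_sum fun σ _ => mul_le_mul_of_nonneg_left (hopt σ) (hw0 σ)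
      _ = _ := by rw [← Finset.sum_mul, hw1, one_mul]
  have e2 : ∑ a, ∑ b, D a b * ⟪x a, p b⟫ = ∑ a, ⟪x a, p a⟫
      + (1 / m) * (∑ t ∈ Finset.range m, ⟪x (i (t+1)), p (i t)⟫
        - ∑ t ∈ Finset.range m, ⟪x (i t), p (i t)⟫) := by
    have f1 : ∑ a, ∑ b, c a b * ⟪x a, p b⟫ = ∑ t ∈ Finset.range m, ⟪x (i (t+1)), p (i t)⟫ := by
      simp only [c, Finset.sum_mul]
      simp_rw [Finset.sum_comm (s := Finset.univ) (t := Finset.range m)]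
      refine Finset.sum_congr rfl fun t _ => ?_
      simp [ite_and, Finset.sum_ite_eq]
    have f2 : ∑ a, d a * ⟪x a, p a⟫ = ∑ t ∈ Finset.range m, ⟪x (i t), p (i t)⟫ := by
      simp only [d, Finset.sum_mul]
      rw [Finset.sum_comm]
      refine Finset.sum_congr rfl fun t _ => ?_
      simp
    rw [← f1, ← f2, mul_sub, Finset.mul_sum, Finset.mul_sum, ← add_sub_assoc,
      ← Finset.sum_add_distrib]
    rw [← Finset.sum_sub_distrib]
    refine Finset.sum_congr rfl fun a _ => ?_
    simp only [D, Matrix.of_apply, add_mul, Finset.sum_add_distrib, Finset.mul_sum, ite_mul,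
      zero_mul, Finset.sum_ite_eq, Finset.mem_univ, if_true]
    have : ∑ b, c a b / m * ⟪x a, p b⟫ = ∑ b, 1 / m * (c a b * ⟪x a, p b⟫) :=
      Finset.sum_congr rfl fun b _ => by ring
    rw [this]; ring
  rw [e2] at key
  have k2 : (1 / (m:ℝ)) * (∑ t ∈ Finset.range m, ⟪x (i (t+1)), p (i t)⟫
        - ∑ t ∈ Finset.range m, ⟪x (i t), p (i t)⟫) ≤ 0 := by linarith
  have k3 := nonpos_of_mul_nonpos_right k2 (by positivity)
  rw [← Finset.sum_sub_distrib] at k3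
  refine le_trans (le_of_eq ?_) k3
  refine Finset.sum_congr rfl fun t _ => ?_
  rw [← hi, ← hi, inner_sub_left]


section B
variable {E : Type*} [NormedAddCommGroup E] [InnerProductSpace ℝ E] [MeasurableSpace E]
  [BorelSpace E] [SecondCountableTopology E]

lemma ae_norm_snd {ν : Measure E} {R : ℝ} (hν : ∀ᵐ y ∂ν, ‖y‖ ≤ R) {γ : Measure (E × E)}
    (h2 : γ.map Prod.snd = ν) : ∀ᵐ q ∂γ, ‖q.2‖ ≤ R := by
  subst h2
  exact ae_of_ae_map measurable_snd.aemeasurable hν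

lemma integrable_fst_norm {μ : Measure E} (hmom : Integrable (fun y => ‖y‖) μ)
    {γ : Measure (E × E)}
    (h1 : γ.map Prod.fst = μ) : Integrable (fun q : E × E => ‖q.1‖) γ := by
  subst h1
  exact hmom.comp_measurable measurable_fst

lemma integrable_inner {μ ν : Measure E} (hmom : Integrable (fun y => ‖y‖) μ) {R : ℝ}
    (hν : ∀ᵐ y ∂ν, ‖y‖ ≤ R) {γ : Measure (E × E)}
    (h1 : γ.map Prod.fst = μ) (h2 : γ.map Prod.snd = ν) :
    Integrable (fun q : E × E => ⟪q.1, q.2⟫) γ := by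
  have hc : Continuous (fun q : E × E => ⟪q.1, q.2⟫) := by fun_prop
  refine ((integrable_fst_norm hmom h1).mul_const R).mono' hc.measurable.aestronglyMeasurable ?_
  filter_upwards [ae_norm_snd hν h2] with q hq
  exact (norm_inner_le_norm _ _).trans (mul_le_mul_of_nonneg_left hq (norm_nonneg _))

lemma optimal_of_CM {μ ν : Measure E} [IsProbabilityMeasure μ]
    (hmom : Integrable (fun y => ‖y‖) μ) {R : ℝ}
    (hν : ∀ᵐ y ∂ν, ‖y‖ ≤ R) {γs : Measure (E × E)} [IsProbabilityMeasure γs]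
    (hs1 : γs.map Prod.fst = μ) (hs2 : γs.map Prod.snd = ν) (hCM : CM γs.support)
    {γ : Measure (E × E)} [IsProbabilityMeasure γ]
    (h1 : γ.map Prod.fst = μ) (h2 : γ.map Prod.snd = ν) :
    ∫ q, ⟪q.1, q.2⟫ ∂γ ≤ ∫ q, ⟪q.1, q.2⟫ ∂γs := by
  have hsub : ∀ q ∈ γs.support, ‖q.2‖ ≤ R := by
    intro q hq
    exact Measure.support_subset_of_isClosed (t := {q : E × E | ‖q.2‖ ≤ R})
      (isClosed_le (by fun_prop) (by fun_prop)) (ae_norm_snd hν hs2) hq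
  have hae : ∀ᵐ q ∂γs, q ∈ γs.support := Measure.support_mem_ae
  have hne : γs.support.Nonempty := hae.exists
  obtain ⟨φ, hlip, hsubg⟩ := rockafellar hCM hne hsub
  have hR0 : 0 ≤ R := by
    obtain ⟨q, hq⟩ := hne
    exact (norm_nonneg _).trans (hsub q hq)
  have hφc : Continuous φ := by
    refine (LipschitzWith.of_le_add_mul (Real.toNNReal R) (f := φ) fun x y => ?_).continuous
    rw [Real.coe_toNNReal _ hR0, dist_eq_norm]
    exact hlip x y
  have hφi : Integrable φ μ := by
    refine ((integrable_const |φ 0|).add (hmom.const_mul R)).mono'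
      hφc.measurable.aestronglyMeasurable (Eventually.of_forall fun x => ?_)
    have a1 := hlip x 0
    have a2 := hlip 0 x
    simp only [sub_zero, zero_sub, norm_neg] at a1 a2
    have b1 := le_abs_self (φ 0)
    have b2 := neg_abs_le (φ 0)
    simp only [Real.norm_eq_abs, Pi.add_apply]
    rw [abs_le]; constructor <;> linarith
  let z := TopologicalSpace.denseSeq E
  let G : E → ℕ → ℝ := fun b i => ⟪z i, b⟫ - φ (z i)
  let ψ : E → ℝ := fun b => ⨆ i, G b i
  have hψm : Measurable ψ := by
    refine Measurable.iSup fun i => ?_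
    have : Continuous fun b => ⟪z i, b⟫ - φ (z i) := by fun_prop
    exact this.measurable
  have hub : ∀ q ∈ γs.support, ∀ i, G q.2 i ≤ ⟪q.1, q.2⟫ - φ q.1 := by
    intro q hq i
    have := hsubg q hq (z i)
    rw [inner_sub_left] at this
    simp only [G]; linarith
  have hfen : ∀ b, BddAbove (Set.range (G b)) → ∀ a, ⟪a, b⟫ - φ a ≤ ψ b := by
    intro b hb a
    have hcl : IsClosed {a : E | ⟪a, b⟫ - φ a ≤ ψ b} :=
      isClosed_le (by fun_prop) (by fun_prop)
    have : Set.range z ⊆ {a : E | ⟪a, b⟫ - φ a ≤ ψ b} := by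
      rintro _ ⟨i, rfl⟩
      exact le_ciSup hb i
    have h3 := closure_minimal this hcl
    rw [(TopologicalSpace.denseRange_denseSeq E).closure_range] at h3
    exact h3 (Set.mem_univ a)
  have hbdd : ∀ q ∈ γs.support, BddAbove (Set.range (G q.2)) := by
    intro q hq
    refine ⟨⟪q.1, q.2⟫ - φ q.1, ?_⟩
    rintro _ ⟨i, rfl⟩
    exact hub q hq i
  have hψeq : ∀ q ∈ γs.support, ψ q.2 = ⟪q.1, q.2⟫ - φ q.1 := by
    intro q hq
    exact le_antisymm (ciSup_le (hub q hq)) (hfen _ (hbdd q hq) _)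
  have hfen' : ∀ᵐ b ∂ν, ∀ a, ⟪a, b⟫ - φ a ≤ ψ b := by
    have hmeas : MeasurableSet {b | ∀ i, ⟪z i, b⟫ - φ (z i) ≤ ψ b} := by
      rw [show {b | ∀ i, ⟪z i, b⟫ - φ (z i) ≤ ψ b} = ⋂ i, {b | ⟪z i, b⟫ - φ (z i) ≤ ψ b} by
        ext; simp]
      refine MeasurableSet.iInter fun i => measurableSet_le ?_ hψm
      have : Continuous fun b => ⟪z i, b⟫ - φ (z i) := by fun_prop
      exact this.measurable
    have h3 : ∀ᵐ b ∂ν, ∀ i, ⟪z i, b⟫ - φ (z i) ≤ ψ b := by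
      rw [← hs2, ae_map_iff measurable_snd.aemeasurable hmeas]
      filter_upwards [hae] with q hq i
      exact le_ciSup (hbdd q hq) i
    filter_upwards [h3] with b hb a
    exact hfen b ⟨ψ b, by rintro _ ⟨i, rfl⟩; exact hb i⟩ a
  have hφs : Integrable (fun q : E × E => φ q.1) γs := by
    rw [← hs1] at hφi; exact hφi.comp_measurable measurable_fst
  have hφg : Integrable (fun q : E × E => φ q.1) γ := by
    rw [← h1] at hφi; exact hφi.comp_measurable measurable_fst
  have hins := integrable_inner hmom hν hs1 hs2
  have hing := integrable_inner hmom hν h1 h2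
  have hψs : Integrable (fun q : E × E => ψ q.2) γs := by
    refine (hins.sub hφs).congr ?_
    filter_upwards [hae] with q hq
    simp [hψeq q hq]
  have hψi : Integrable ψ ν := by
    rw [← hs2]
    exact (integrable_map_measure hψm.aestronglyMeasurable measurable_snd.aemeasurable).2 hψs
  have hψg : Integrable (fun q : E × E => ψ q.2) γ := by
    rw [← h2] at hψi; exact hψi.comp_measurable measurable_snd
  have eφ : ∫ q, φ q.1 ∂γ = ∫ q, φ q.1 ∂γs := by
    rw [← integral_map measurable_fst.aemeasurable hφc.measurable.aestronglyMeasurable,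
      ← integral_map measurable_fst.aemeasurable hφc.measurable.aestronglyMeasurable, h1, hs1]
  have eψ : ∫ q, ψ q.2 ∂γ = ∫ q, ψ q.2 ∂γs := by
    rw [← integral_map measurable_snd.aemeasurable hψm.aestronglyMeasurable,
      ← integral_map measurable_snd.aemeasurable hψm.aestronglyMeasurable, h2, hs2]
  calc ∫ q, ⟪q.1, q.2⟫ ∂γ ≤ ∫ q, (φ q.1 + ψ q.2) ∂γ := by
        refine integral_mono_ae hing (hφg.add hψg) ?_
        have : ∀ᵐ q ∂γ, ∀ a, ⟪a, q.2⟫ - φ a ≤ ψ q.2 := by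
          rw [← h2] at hfen'
          exact ae_of_ae_map measurable_snd.aemeasurable hfen'
        filter_upwards [this] with q hq
        have := hq q.1
        linarith
    _ = ∫ q, (φ q.1 + ψ q.2) ∂γs := by
        rw [integral_add hφg hψg, integral_add hφs hψs, eφ, eψ]
    _ = ∫ q, ⟪q.1, q.2⟫ ∂γs := by
        refine integral_congr_ae ?_
        filter_upwards [hae] with q hq
        rw [hψeq q hq]; ring

end B


/-- empirical measure on a general space -/
noncomputable def emp {X : Type*} [MeasurableSpace X] (N : ℕ) (z : Fin N → X) : Measure X :=
  (N : ℝ≥0∞)⁻¹ • ∑ i : Fin N, Measure.dirac (z i)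

section C
variable {X : Type*} [MeasurableSpace X]

lemma integrable_emp [MeasurableSingletonClass X] {N : ℕ} (hN : 0 < N) (z : Fin N → X)
    (f : X → ℝ) : Integrable f (emp N z) := by
  refine Integrable.smul_measure ?_ (by simp [hN.ne'])
  rw [integrable_finsetSum_measure]
  intro i _
  exact integrable_dirac (by simp)

lemma integral_emp [MeasurableSingletonClass X] {N : ℕ} (z : Fin N → X)
    (f : X → ℝ) : ∫ a, f a ∂(emp N z) = (1 / (N : ℝ)) * ∑ i, f (z i) := by
  rw [emp, integral_smul_measure, integral_finsetSum_measure]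
  · simp
  · intro i _
    exact integrable_dirac (by simp)

lemma prob_emp {N : ℕ} (hN : 0 < N) (z : Fin N → X) : IsProbabilityMeasure (emp N z) := by
  constructor
  simp only [emp, Measure.smul_apply, Measure.finsetSum_apply, measure_univ, smul_eq_mul]
  simp only [Finset.sum_const, Finset.card_univ, Fintype.card_fin, nsmul_eq_mul, mul_one]
  exact ENNReal.inv_mul_cancel (by simp [hN.ne']) (by simp)

lemma map_emp {Y : Type*} [MeasurableSpace Y] {N : ℕ} (z : Fin N → X) {g : X → Y}
    (hg : Measurable g) : (emp N z).map g = emp N (g ∘ z) := by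
  rw [emp, Measure.map_smul, Measure.map_finset_sum' hg.aemeasurable]
  simp [emp, Measure.map_dirac' hg]

lemma ae_emp [MeasurableSingletonClass X] {N : ℕ} (z : Fin N → X) {p : X → Prop}
    (h : ∀ i, p (z i)) : ∀ᵐ a ∂(emp N z), p a := by
  refine Measure.ae_smul_measure ?_ _
  rw [ae_iff, Measure.finsetSum_apply]
  refine Finset.sum_eq_zero fun i _ => ?_
  rw [Measure.dirac_apply]
  simp [h i]

variable [TopologicalSpace X] [BorelSpace X]

lemma lsc_integral {G : Filter ℕ} {γk : ℕ → Measure X} {γ : Measure X}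
    (hw : ∀ f : X →ᵇ ℝ, Tendsto (fun k => ∫ a, f a ∂(γk k)) G (𝓝 (∫ a, f a ∂γ)))
    (hprob : ∀ k, IsProbabilityMeasure (γk k)) {g : X → ℝ} (hg : Continuous g) (hg0 : ∀ a, 0 ≤ g a)
    (hgi : Integrable g γ) (hgk : ∀ k, Integrable g (γk k)) {ε : ℝ} (hε : 0 < ε) :
    ∀ᶠ k in G, ∫ a, g a ∂γ - ε ≤ ∫ a, g a ∂(γk k) := by
  have hlim : Tendsto (fun M : ℕ => ∫ a, min (g a) M ∂γ) atTop (𝓝 (∫ a, g a ∂γ)) := by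
    refine tendsto_integral_of_dominated_convergence g
      (fun M => (hg.min continuous_const).measurable.aestronglyMeasurable) hgi
      (fun M => Eventually.of_forall fun a => ?_) (Eventually.of_forall fun a => ?_)
    · rw [Real.norm_of_nonneg (le_min (hg0 a) (Nat.cast_nonneg M))]
      exact min_le_left _ _
    · refine tendsto_const_nhds.congr' ?_
      filter_upwards [eventually_ge_atTop ⌈g a⌉₊] with M hM
      rw [min_eq_left]
      exact (Nat.le_ceil _).trans (by exact_mod_cast hM)
  obtain ⟨M, hM⟩ := (hlim.eventually (lt_mem_nhds (sub_lt_self _ (half_pos hε)))).exists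
  let f : X →ᵇ ℝ := BoundedContinuousFunction.ofNormedAddCommGroup (fun a => min (g a) M)
    (hg.min continuous_const) M (fun a => by
      rw [Real.norm_of_nonneg (le_min (hg0 a) (Nat.cast_nonneg M))]
      exact min_le_right _ _)
  filter_upwards [(hw f).eventually (lt_mem_nhds (sub_lt_self _ (half_pos hε)))] with k hk
  have h1 : ∫ a, f a ∂(γk k) ≤ ∫ a, g a ∂(γk k) :=
    integral_mono (f.integrable _) (hgk k) fun a => min_le_left _ _
  have h2 : ∫ a, f a ∂γ = ∫ a, min (g a) M ∂γ := rfl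
  linarith

end C

lemma exists_near {X : Type*} [MeasurableSpace X] [PseudoMetricSpace X] [BorelSpace X]
    [MeasurableSingletonClass X]
    {G : Filter ℕ} {N : ℕ → ℕ} (z : (k : ℕ) → Fin (N k) → X) {γ : Measure X} [IsFiniteMeasure γ]
    (hw : ∀ f : X →ᵇ ℝ, Tendsto (fun k => ∫ a, f a ∂(emp (N k) (z k))) G (𝓝 (∫ a, f a ∂γ)))
    {a : X} (ha : a ∈ γ.support) {ε : ℝ} (hε : 0 < ε) :
    ∀ᶠ k in G, ∃ i, dist (z k i) a < ε := by
  let f : X →ᵇ ℝ := BoundedContinuousFunction.ofNormedAddCommGroup (fun b => max 0 (ε - dist b a))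
    (by fun_prop) ε (fun b => by
      rw [Real.norm_of_nonneg (le_max_left _ _)]
      refine max_le hε.le ?_
      have := dist_nonneg (x := b) (y := a)
      linarith)
  have hpos : 0 < ∫ b, f b ∂γ := by
    have hnn : 0 ≤ (f : X → ℝ) := fun b => le_max_left _ _
    rw [integral_pos_iff_support_of_nonneg hnn (f.integrable _)]
    have h1 : 0 < γ (Metric.ball a ε) :=
      (Metric.nhds_basis_ball.mem_measureSupport).1 ha ε hε
    refine h1.trans_le (measure_mono fun b hb => ?_)
    have : dist b a < ε := hb
    have h2 : 0 < f b := lt_max_of_lt_right (by linarith)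
    exact h2.ne'
  filter_upwards [(hw f).eventually (lt_mem_nhds hpos)] with k hk
  by_contra! hcon
  rw [integral_emp] at hk
  have : ∀ i, f (z k i) = 0 := fun i => max_eq_left (by linarith [hcon i])
  simp [this] at hk

lemma limit_CM {E : Type*} [NormedAddCommGroup E] [InnerProductSpace ℝ E] [MeasurableSpace E]
    [BorelSpace E] [SecondCountableTopology E]
    {G : Filter ℕ} [G.NeBot] {N : ℕ → ℕ} (hN : ∀ k, 0 < N k)
    (z : (k : ℕ) → Fin (N k) → E × E) {γ : Measure (E × E)} [IsFiniteMeasure γ]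
    (hw : ∀ f : (E × E) →ᵇ ℝ, Tendsto (fun k => ∫ a, f a ∂(emp (N k) (z k))) G (𝓝 (∫ a, f a ∂γ)))
    (hCM : ∀ k, CM (Set.range (z k))) : CM γ.support := by
  intro m q hq hm
  have hex : ∀ k (a : E × E), ∃ i, ∀ j, dist (z k i) a ≤ dist (z k j) a := by
    intro k a
    have : Nonempty (Fin (N k)) := ⟨⟨0, hN k⟩⟩
    exact Finite.exists_min fun i => dist (z k i) a
  choose J hJ using hex
  have hconv : ∀ a ∈ γ.support, Tendsto (fun k => z k (J k a)) G (𝓝 a) := by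
    intro a ha
    rw [Metric.tendsto_nhds]
    intro ε hε
    filter_upwards [exists_near z hw ha hε] with k hk
    obtain ⟨i, hi⟩ := hk
    exact (hJ k a i).trans_lt hi
  have hF : Tendsto (fun k => ∑ t ∈ Finset.range m,
      ⟪(z k (J k (q (t + 1)))).1 - (z k (J k (q t))).1, (z k (J k (q t))).2⟫) G
      (𝓝 (∑ t ∈ Finset.range m, ⟪(q (t + 1)).1 - (q t).1, (q t).2⟫)) := by
    refine tendsto_finsetSum _ fun t _ => ?_
    have h1 := hconv _ (hq (t+1))
    have h2 := hconv _ (hq t)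
    exact ((h1.fst_nhds).sub (h2.fst_nhds)).inner (h2.snd_nhds)
  refine le_of_tendsto hF (Eventually.of_forall fun k => ?_)
  exact hCM k m (fun t => z k (J k (q t))) (fun t => ⟨_, rfl⟩) (by simp only [hm])

open scoped Pointwise in
open BoxIntegral.unitPartition in
lemma lattice_sum {n : ℕ} {P : Set (EuclideanSpace ℝ (Fin n))}
    (hconv : Convex ℝ P) (hcomp : IsCompact P)
    (N : ℕ → ℕ) (pts : (k : ℕ) → Fin (N k) → EuclideanSpace ℝ (Fin n))
    (hinj : ∀ k, Function.Injective (pts k)) (hrange : ∀ k, Set.range (pts k) = lattPts P k)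
    (f : EuclideanSpace ℝ (Fin n) → ℝ) (hf : Continuous f) :
    Tendsto (fun k => (∑ i, f (pts k i)) / (k : ℝ) ^ n) atTop (𝓝 (∫ y in P, f y)) := by
  let e := EuclideanSpace.equiv (Fin n) ℝ
  let s : Set (Fin n → ℝ) := WithLp.toLp 2 ⁻¹' P
  have hs : s = e '' P := by
    ext v
    constructor
    · intro hv; exact ⟨WithLp.toLp 2 v, hv, rfl⟩
    · rintro ⟨w, hw, rfl⟩; exact hw
  have hsc : IsCompact s := hs ▸ hcomp.image e.continuous
  have hsconv : Convex ℝ s := hs ▸ hconv.linear_image e.toLinearEquiv.toLinearMap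
  have key := tendsto_tsum_div_pow_atTop_integral s (fun v => f (WithLp.toLp 2 v))
    (by fun_prop) hsc.isBounded hsc.measurableSet (hsconv.addHaar_frontier volume)
  have hint : ∫ v in s, f (WithLp.toLp 2 v) = ∫ y in P, f y :=
    (PiLp.volume_preserving_toLp (Fin n)).setIntegral_preimage_emb
      (MeasurableEquiv.toLp 2 (Fin n → ℝ)).measurableEmbedding f P
  rw [hint, Fintype.card_fin] at key
  refine key.congr' ?_
  filter_upwards [eventually_gt_atTop 0] with k hk
  congr 1
  have : NeZero k := ⟨hk.ne'⟩
  have hk0 : (k:ℝ) ≠ 0 := by exact_mod_cast hk.ne'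
  have hmem : ∀ v : Fin n → ℝ, v ∈ s ∩ ((k:ℝ)⁻¹ • (Submodule.span ℤ (Set.range (Pi.basisFun ℝ (Fin n))) : Set (Fin n → ℝ)))
      ↔ WithLp.toLp 2 v ∈ Set.range (pts k) := by
    intro v
    rw [hrange, lattPts]
    have h2 := mem_smul_span_iff (n := k) (v := v)
    rw [← SetLike.mem_coe, Submodule.coe_pointwise_smul] at h2
    refine and_congr Iff.rfl (h2.trans (forall_congr' fun i => ?_))
    constructor
    · rintro ⟨a, ha⟩
      refine ⟨a, ?_⟩
      simp only [algebraMap_int_eq, eq_intCast] at ha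
      rw [eq_div_iff hk0, ha]; exact mul_comm _ _
    · rintro ⟨a, ha⟩
      refine ⟨a, ?_⟩
      simp only [algebraMap_int_eq, eq_intCast]
      rw [eq_div_iff hk0] at ha
      rw [← ha]; exact mul_comm _ _
  let g : Fin (N k) → ↑(s ∩ ((k:ℝ)⁻¹ • (Submodule.span ℤ (Set.range (Pi.basisFun ℝ (Fin n))) : Set (Fin n → ℝ)))) :=
    fun i => ⟨WithLp.ofLp (pts k i), (hmem _).2 ⟨i, rfl⟩⟩
  have hg : Function.Bijective g := by
    constructor
    · intro i j hij
      refine hinj k (WithLp.ofLp_injective 2 ?_)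
      exact congrArg Subtype.val hij
    · rintro ⟨v, hv⟩
      obtain ⟨i, hi⟩ := (hmem v).1 hv
      refine ⟨i, Subtype.ext ?_⟩
      change WithLp.ofLp (pts k i) = v
      rw [hi]
  rw [← (Equiv.ofBijective g hg).tsum_eq, tsum_fintype]
  rfl

lemma N_pos {n : ℕ} {P : Set (EuclideanSpace ℝ (Fin n))}
    (h0 : (0 : EuclideanSpace ℝ (Fin n)) ∈ interior P)
    (N : ℕ → ℕ) (pts : (k : ℕ) → Fin (N k) → EuclideanSpace ℝ (Fin n))
    (hrange : ∀ k, Set.range (pts k) = lattPts P k) (k : ℕ) : 0 < N k := by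
  have : (0 : EuclideanSpace ℝ (Fin n)) ∈ lattPts P k :=
    ⟨interior_subset h0, fun i => ⟨0, by simp⟩⟩
  rw [← hrange] at this
  obtain ⟨i, -⟩ := this
  exact i.pos

lemma vol_pos {n : ℕ} {P : Set (EuclideanSpace ℝ (Fin n))}
    (h0 : (0 : EuclideanSpace ℝ (Fin n)) ∈ interior P) : 0 < volume P :=
  Measure.measure_pos_of_nonempty_interior _ ⟨0, h0⟩

lemma lattice_weak {n : ℕ} {P : Set (EuclideanSpace ℝ (Fin n))}
    (hconv : Convex ℝ P) (hcomp : IsCompact P) (h0 : (0 : EuclideanSpace ℝ (Fin n)) ∈ interior P)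
    (N : ℕ → ℕ) (pts : (k : ℕ) → Fin (N k) → EuclideanSpace ℝ (Fin n))
    (hinj : ∀ k, Function.Injective (pts k)) (hrange : ∀ k, Set.range (pts k) = lattPts P k)
    (f : EuclideanSpace ℝ (Fin n) →ᵇ ℝ) :
    Tendsto (fun k => ∫ y, f y ∂(emp (N k) (pts k))) atTop (𝓝 (∫ y, f y ∂(unifOn P))) := by
  have h1 := lattice_sum hconv hcomp N pts hinj hrange f f.continuous
  have h2 := lattice_sum hconv hcomp N pts hinj hrange (fun _ => 1) continuous_const
  have hv : 0 < volume.real P :=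
    ENNReal.toReal_pos (vol_pos h0).ne' hcomp.measure_lt_top.ne
  simp only [setIntegral_const, smul_eq_mul, mul_one] at h2
  have h3 := h1.div h2 hv.ne'
  have e : ∫ y, f y ∂(unifOn P) = (∫ y in P, f y) / volume.real P := by
    rw [unifOn, integral_smul_measure, ENNReal.toReal_inv, smul_eq_mul, div_eq_inv_mul]; rfl
  rw [e]
  refine h3.congr' ?_
  filter_upwards [eventually_gt_atTop 0] with k hk
  have hk0 : (k:ℝ) ≠ 0 := by exact_mod_cast hk.ne'
  have hN : (N k : ℝ) ≠ 0 := by exact_mod_cast (N_pos h0 N pts hrange k).ne'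
  rw [integral_emp]
  simp only [Pi.div_apply, Finset.sum_const, Finset.card_univ, Fintype.card_fin, nsmul_eq_mul,
    mul_one]
  field_simp

lemma prob_unif {n : ℕ} {P : Set (EuclideanSpace ℝ (Fin n))}
    (hcomp : IsCompact P) (h0 : (0 : EuclideanSpace ℝ (Fin n)) ∈ interior P) :
    IsProbabilityMeasure (unifOn P) := by
  constructor
  rw [unifOn, Measure.smul_apply, Measure.restrict_apply_univ, smul_eq_mul]
  exact ENNReal.inv_mul_cancel (vol_pos h0).ne' hcomp.measure_lt_top.ne

lemma ae_unif {n : ℕ} {P : Set (EuclideanSpace ℝ (Fin n))}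
    (hcomp : IsCompact P) : ∀ᵐ y ∂(unifOn P), y ∈ P :=
  Measure.ae_smul_measure (ae_restrict_mem hcomp.measurableSet) _


lemma tight_seq {n : ℕ} {P : Set (EuclideanSpace ℝ (Fin n))} (hcomp : IsCompact P)
    {N : ℕ → ℕ} (hN : ∀ k, 0 < N k)
    (z : (k : ℕ) → Fin (N k) → EuclideanSpace ℝ (Fin n) × EuclideanSpace ℝ (Fin n))
    (hP : ∀ k i, (z k i).2 ∈ P) {B : ℝ}
    (hB : ∀ k, ∫ q, ‖q.1‖ ∂(emp (N k) (z k)) ≤ B) :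
    IsTightMeasureSet {ρ | ∃ k, ρ = emp (N k) (z k)} := by
  rw [isTightMeasureSet_iff_exists_isCompact_measure_compl_le]
  intro ε hε
  obtain ⟨δ, hδ0, hδ, hδε⟩ := ENNReal.lt_iff_exists_real_btwn.1 hε
  have hδ' : 0 < δ := by simpa using hδ
  have hB0 : 0 ≤ B := (integral_nonneg fun q => norm_nonneg _).trans (hB 0)
  have hr : 0 < (B + 1) / δ := by positivity
  refine ⟨Metric.closedBall 0 ((B + 1) / δ) ×ˢ P, (isCompact_closedBall _ _).prod hcomp, ?_⟩
  rintro _ ⟨k, rfl⟩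
  have := prob_emp (hN k) (z k)
  refine le_trans ?_ hδε.le
  have hae : ∀ᵐ q ∂(emp (N k) (z k)), q.2 ∈ P := ae_emp _ (hP k)
  have h1 : emp (N k) (z k) (Metric.closedBall 0 ((B + 1) / δ) ×ˢ P)ᶜ
      ≤ emp (N k) (z k) {q | (B + 1) / δ ≤ ‖q.1‖} := by
    refine measure_mono_ae ?_
    filter_upwards [hae] with q hq hq2
    by_contra hcon
    refine hq2 ⟨?_, hq⟩
    rw [mem_closedBall_zero_iff]
    exact (not_le.1 hcon).le
  refine h1.trans ?_
  have h2 := mul_meas_ge_le_integral_of_nonneg (μ := emp (N k) (z k))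
    (f := fun q : EuclideanSpace ℝ (Fin n) × EuclideanSpace ℝ (Fin n) => ‖q.1‖)
    (Eventually.of_forall fun q => norm_nonneg _) (integrable_emp (hN k) _ _) ((B + 1) / δ)
  rw [← ENNReal.ofReal_toReal (measure_ne_top (emp (N k) (z k)) _)]
  refine ENNReal.ofReal_le_ofReal ?_
  have h3 := h2.trans (hB k)
  change (emp (N k) (z k)).real _ ≤ δ
  rw [div_mul_eq_mul_div, div_le_iff₀ hδ'] at h3
  have h4 : 0 ≤ (emp (N k) (z k)).real {q | (B + 1) / δ ≤ ‖q.1‖} := measureReal_nonneg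
  by_contra! hcon
  nlinarith

end TropAux

/-- Let `P ⊂ ℝⁿ` be a convex body with `0 ∈ int P`, and for each `k` let
`p₁,…,p_{N_k}` enumerate `P ∩ (k⁻¹ℤ)ⁿ`. If the empirical measures of configurations
`x^{(k)}` converge weakly to a probability measure `μ` with finite first moment, and
their first moments converge to that of `μ`, then `-E_trop^{(N_k)}(x^{(k)}) → C(μ, ν_P)`,
the optimal transport cost (for `c(x,y) = -⟨x,y⟩`) to the uniform measure on `P`. -/
theorem tropical_energy_convergence_to_transport_cost
    {n : ℕ} (P : Set (EuclideanSpace ℝ (Fin n)))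
    (hconv : Convex ℝ P) (hcomp : IsCompact P) (h0 : (0 : EuclideanSpace ℝ (Fin n)) ∈ interior P)
    (N : ℕ → ℕ) (pts : (k : ℕ) → Fin (N k) → EuclideanSpace ℝ (Fin n))
    (hinj : ∀ k, Function.Injective (pts k)) (hrange : ∀ k, Set.range (pts k) = lattPts P k)
    (μ : Measure (EuclideanSpace ℝ (Fin n))) (hμ : IsProbabilityMeasure μ)
    (hmom : Integrable (fun y => ‖y‖) μ)
    (x : (k : ℕ) → Fin (N k) → EuclideanSpace ℝ (Fin n))
    (hweak : ∀ f : EuclideanSpace ℝ (Fin n) →ᵇ ℝ,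
      Tendsto (fun k => ∫ y, f y ∂(empiricalE (N k) (x k))) atTop (𝓝 (∫ y, f y ∂μ)))
    (hmoments : Tendsto (fun k => ∫ y, ‖y‖ ∂(empiricalE (N k) (x k))) atTop
      (𝓝 (∫ y, ‖y‖ ∂μ))) :
    Tendsto (fun k => -tropEnergy (pts k) (x k)) atTop (𝓝 (otCost μ (unifOn P))) := by
  have hN := TropAux.N_pos h0 N pts hrange
  have hprobU := TropAux.prob_unif hcomp h0
  obtain ⟨R, hR⟩ := hcomp.isBounded.exists_norm_le
  have hptsP : ∀ k i, pts k i ∈ P := fun k i => by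
    have : pts k i ∈ lattPts P k := hrange k ▸ ⟨i, rfl⟩
    exact this.1
  -- optimal permutations
  have hσ : ∀ k, ∃ σ : Equiv.Perm (Fin (N k)), ∀ τ : Equiv.Perm (Fin (N k)),
      ∑ i, ⟪x k i, pts k (τ i)⟫ ≤ ∑ i, ⟪x k i, pts k (σ i)⟫ := fun k =>
    Finite.exists_max fun τ : Equiv.Perm (Fin (N k)) => ∑ i, ⟪x k i, pts k (τ i)⟫
  choose σ hσ using hσ
  let z : (k : ℕ) → Fin (N k) → EuclideanSpace ℝ (Fin n) × EuclideanSpace ℝ (Fin n) :=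
    fun k i => (x k i, pts k (σ k i))
  have hE : ∀ k, tropEnergy (pts k) (x k) = ∫ q, ⟪q.1, q.2⟫ ∂(TropAux.emp (N k) (z k)) := by
    intro k
    rw [TropAux.integral_emp, tropEnergy]
    congr 1
    refine le_antisymm (Finset.sup'_le _ _ fun τ _ => hσ k τ) ?_
    exact Finset.le_sup' (fun τ : Equiv.Perm (Fin (N k)) => ∑ i, ⟪x k i, pts k (τ i)⟫)
      (Finset.mem_univ (σ k))
  have hCM : ∀ k, TropAux.CM (Set.range (z k)) := by
    intro k
    refine TropAux.finite_CM (x k) (fun i => pts k (σ k i)) fun τ => ?_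
    exact hσ k (τ.trans (σ k))
  have hprob : ∀ k, IsProbabilityMeasure (TropAux.emp (N k) (z k)) :=
    fun k => TropAux.prob_emp (hN k) (z k)
  have hm1 : ∀ k, (fun k => ∫ y, ‖y‖ ∂(empiricalE (N k) (x k))) k
      = ∫ q, ‖q.1‖ ∂(TropAux.emp (N k) (z k)) := by
    intro k
    change ∫ y, ‖y‖ ∂(TropAux.emp (N k) (x k)) = _
    rw [TropAux.integral_emp, TropAux.integral_emp]
  have hmoments' := hmoments.congr hm1
  obtain ⟨B, hB⟩ := hmoments'.bddAbove_range
  have htight := TropAux.tight_seq hcomp hN z (fun k i => hptsP k _)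
    (B := B) (fun k => hB ⟨k, rfl⟩)
  let Γ : ℕ → ProbabilityMeasure (EuclideanSpace ℝ (Fin n) × EuclideanSpace ℝ (Fin n)) :=
    fun k => ⟨TropAux.emp (N k) (z k), hprob k⟩
  have hcpt : IsCompact (closure (Set.range Γ)) := by
    refine isCompact_closure_of_isTightMeasureSet (htight.subset ?_)
    rintro _ ⟨_, ⟨k, rfl⟩, rfl⟩
    exact ⟨k, rfl⟩
  rw [tendsto_iff_ultrafilter]
  intro G hG
  obtain ⟨γ, -, hγ⟩ := hcpt.ultrafilter_le_nhds (G.map Γ) (by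
    rw [le_principal_iff]
    exact mem_of_superset (Filter.image_mem_map univ_mem) (by
      rw [Set.image_univ]; exact subset_closure))
  have hw := ProbabilityMeasure.tendsto_iff_forall_integral_tendsto.1
    (show Tendsto Γ (G : Filter ℕ) (𝓝 γ) from hγ)
  change ∀ f : (EuclideanSpace ℝ (Fin n) × EuclideanSpace ℝ (Fin n)) →ᵇ ℝ,
    Tendsto (fun k => ∫ q, f q ∂(TropAux.emp (N k) (z k))) (G : Filter ℕ)
      (𝓝 (∫ q, f q ∂(γ : Measure (EuclideanSpace ℝ (Fin n) × EuclideanSpace ℝ (Fin n))))) at hw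
  -- marginals
  have hg1 : (γ : Measure (EuclideanSpace ℝ (Fin n) × EuclideanSpace ℝ (Fin n))).map Prod.fst = μ := by
    have : IsProbabilityMeasure ((γ : Measure (EuclideanSpace ℝ (Fin n) ×
      EuclideanSpace ℝ (Fin n))).map Prod.fst) :=
      Measure.isProbabilityMeasure_map measurable_fst.aemeasurable
    refine ext_of_forall_integral_eq_of_IsFiniteMeasure fun f => ?_
    rw [integral_map measurable_fst.aemeasurable f.continuous.measurable.aestronglyMeasurable]
    refine tendsto_nhds_unique (hw (f.compContinuous ⟨Prod.fst, continuous_fst⟩)) ?_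
    refine ((hweak f).mono_left hG).congr fun k => ?_
    change ∫ y, f y ∂(TropAux.emp (N k) (x k)) = _
    rw [TropAux.integral_emp, TropAux.integral_emp]
    rfl
  have hg2 : (γ : Measure (EuclideanSpace ℝ (Fin n) × EuclideanSpace ℝ (Fin n))).map Prod.snd = unifOn P := by
    have : IsProbabilityMeasure ((γ : Measure (EuclideanSpace ℝ (Fin n) ×
      EuclideanSpace ℝ (Fin n))).map Prod.snd) :=
      Measure.isProbabilityMeasure_map measurable_snd.aemeasurable
    refine ext_of_forall_integral_eq_of_IsFiniteMeasure fun f => ?_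
    rw [integral_map measurable_snd.aemeasurable f.continuous.measurable.aestronglyMeasurable]
    refine tendsto_nhds_unique (hw (f.compContinuous ⟨Prod.snd, continuous_snd⟩)) ?_
    refine ((TropAux.lattice_weak hconv hcomp h0 N pts hinj hrange f).mono_left hG).congr
      fun k => ?_
    rw [TropAux.integral_emp, TropAux.integral_emp]
    congr 1
    exact (Equiv.sum_comp (σ k) fun i => f (pts k i)).symm
  have hν : ∀ᵐ y ∂(unifOn P), ‖y‖ ≤ R := (TropAux.ae_unif hcomp).mono fun y hy => hR y hy
  have hSCM := TropAux.limit_CM hN z hw hCM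
  have hot : otCost μ (unifOn P) = - ∫ q, ⟪q.1, q.2⟫ ∂(γ : Measure (EuclideanSpace ℝ (Fin n) × EuclideanSpace ℝ (Fin n))) := by
    refine IsLeast.csInf_eq ⟨⟨γ, inferInstance, hg1, hg2, (integral_neg _).symm⟩, ?_⟩
    rintro _ ⟨γ', hp', h1', h2', rfl⟩
    rw [integral_neg, neg_le_neg_iff]
    exact TropAux.optimal_of_CM hmom hν hg1 hg2 hSCM h1' h2'
  rw [hot]
  refine Tendsto.neg ?_
  simp_rw [hE]
  -- convergence of the energies
  have hinn := TropAux.integrable_inner hmom hν hg1 hg2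
  have hnor := (TropAux.integrable_fst_norm hmom hg1).const_mul R
  have hnorm : Tendsto (fun k => ∫ q, R * ‖q.1‖ ∂(TropAux.emp (N k) (z k))) (G : Filter ℕ)
      (𝓝 (∫ q, R * ‖q.1‖ ∂(γ : Measure (EuclideanSpace ℝ (Fin n) × EuclideanSpace ℝ (Fin n))))) := by
    simp_rw [integral_const_mul]
    refine Tendsto.const_mul R ?_
    have : ∫ q, ‖q.1‖ ∂(γ : Measure (EuclideanSpace ℝ (Fin n) × EuclideanSpace ℝ (Fin n)))
        = ∫ y, ‖y‖ ∂μ := by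
      rw [← hg1, integral_map measurable_fst.aemeasurable
        continuous_norm.measurable.aestronglyMeasurable]
    rw [this]
    exact hmoments'.mono_left hG
  have habs : ∀ q : EuclideanSpace ℝ (Fin n) × EuclideanSpace ℝ (Fin n), ‖q.2‖ ≤ R →
      |⟪q.1, q.2⟫| ≤ R * ‖q.1‖ := by
    intro q hq
    refine (abs_real_inner_le_norm _ _).trans ?_
    rw [mul_comm]
    exact mul_le_mul_of_nonneg_right hq (norm_nonneg _)
  have hzR : ∀ k, ∀ᵐ q ∂(TropAux.emp (N k) (z k)), ‖q.2‖ ≤ R := fun k =>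
    TropAux.ae_emp _ fun i => hR _ (hptsP k _)
  have side : ∀ s : ℝ, |s| = 1 → ∀ ε > 0, ∀ᶠ k in (G : Filter ℕ),
      s * ∫ q, ⟪q.1, q.2⟫ ∂(γ : Measure (EuclideanSpace ℝ (Fin n) × EuclideanSpace ℝ (Fin n))) - ε
        ≤ s * ∫ q, ⟪q.1, q.2⟫ ∂(TropAux.emp (N k) (z k)) := by
    intro s hs ε hε
    let g : EuclideanSpace ℝ (Fin n) × EuclideanSpace ℝ (Fin n) → ℝ :=
      fun q => max 0 (R * ‖q.1‖ + s * ⟪q.1, q.2⟫)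
    have hgeq : ∀ ρ : Measure (EuclideanSpace ℝ (Fin n) × EuclideanSpace ℝ (Fin n)),
        (∀ᵐ q ∂ρ, ‖q.2‖ ≤ R) → g =ᵐ[ρ] fun q => R * ‖q.1‖ + s * ⟪q.1, q.2⟫ := by
      intro ρ hρ
      filter_upwards [hρ] with q hq
      refine max_eq_right ?_
      have h1 := habs q hq
      have h2 : |s * ⟪q.1, q.2⟫| ≤ R * ‖q.1‖ := by rw [abs_mul, hs, one_mul]; exact h1
      linarith [(abs_le.1 h2).1]
    have hgγ := hgeq γ (TropAux.ae_norm_snd hν hg2)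
    have hgk := fun k => hgeq _ (hzR k)
    have hgi : Integrable g (γ : Measure (EuclideanSpace ℝ (Fin n) × EuclideanSpace ℝ (Fin n))) :=
      (integrable_congr hgγ).2 (hnor.add (hinn.const_mul s))
    have hgc : Continuous g := by fun_prop
    have hl := TropAux.lsc_integral hw hprob hgc (fun q => le_max_left _ _) hgi
      (fun k => TropAux.integrable_emp (hN k) _ _) (half_pos hε)
    filter_upwards [hl, hnorm.eventually (gt_mem_nhds (lt_add_of_pos_right _ (half_pos hε)))]
      with k hk1 hk2
    rw [integral_congr_ae hgγ, integral_congr_ae (hgk k),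
      integral_add hnor (hinn.const_mul s), integral_add (TropAux.integrable_emp (hN k) _ _)
        (TropAux.integrable_emp (hN k) _ _), integral_const_mul s, integral_const_mul s] at hk1
    linarith
  rw [Metric.tendsto_nhds]
  intro ε hε
  filter_upwards [side 1 (by simp) (ε / 2) (half_pos hε),
    side (-1) (by simp) (ε / 2) (half_pos hε)] with k h1 h2
  rw [Real.dist_eq, abs_lt]
  constructor <;> linarith
end
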